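/- Let k be a field of prime characteristic p and let n ≥ 1. Let V ⊆ k[x₁,…,x_n] be the k-span of the monomials x₁^{a₁}⋯x_n^{a_n} with 0 ≤ a_i ≤ n−i for each i, and define the k-linear map ∂ : V → V by ∂(x^a) := Σ_{i=1}^{n} (a_i − (n−i))·x₁^{a₁}⋯x_i^{a_i+1}⋯x_n^{a_n} (the terms with a_i = n−i have zero coefficient, so ∂ does map V into V). Then ∂^p = 0 on V, and if n ≥ p then V is acyclic: ker(∂^i) = im(∂^{p−i}) for every 1 ≤ i ≤ p−1. -/

import Mathlib

set_option maxHeartbeats 1000000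
set_option synthInstance.maxHeartbeats 400000

noncomputable section

/-- The index set of the monomial basis `B_n = {x₁^{a₁}⋯x_n^{a_n} : 0 ≤ a_i ≤ n-i}`
(0-based: the exponent at the `i`-th variable lies in `Fin (n - i)`). -/
abbrev BoxIdx (n : ℕ) := ∀ i : Fin n, Fin (n - i.val)

/-- The matrix of the differential `∂(x^a) = Σ_i (a_i - (n-i))·x^{a+e_i}` on the span
`V` of `B_n` (the terms with top exponent `a_i = n - i` have zero coefficient and are
omitted, so `∂` maps `V` into `V`). -/
def boxMat (k : Type*) [Field k] (n : ℕ) : Matrix (BoxIdx n) (BoxIdx n) k :=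
  fun b a => ∑ i : Fin n,
    if h : (a i).val + 1 < n - i.val then
      (if b = Function.update a i ⟨(a i).val + 1, h⟩ then
        ((a i).val : k) - ((n - 1 - i.val : ℕ) : k)
      else 0)
    else 0

/-- The differential `∂` on `V = span(B_n)`, in the monomial basis. -/
def boxD (k : Type*) [Field k] (n : ℕ) : (BoxIdx n → k) →ₗ[k] (BoxIdx n → k) :=
  (boxMat k n).mulVecLin

section TruncatedPolynomials

/-- Lower the `i`-th exponent of `b` by `j`, stopping at `0`. -/
def BoxIdx.lower {n : ℕ} (b : BoxIdx n) (i : Fin n) (j : ℕ) : BoxIdx n :=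
  Function.update b i ⟨(b i).val - j, lt_of_le_of_lt (Nat.sub_le _ _) (b i).isLt⟩

@[simp]
theorem BoxIdx.lower_same {n : ℕ} (b : BoxIdx n) (i : Fin n) (j : ℕ) :
    (b.lower i j i).val = (b i).val - j := by
  simp [BoxIdx.lower]

theorem BoxIdx.lower_of_ne {n : ℕ} (b : BoxIdx n) {i l : Fin n} (h : l ≠ i) (j : ℕ) :
    b.lower i j l = b l := by
  simp [BoxIdx.lower, h]

theorem BoxIdx.lower_lower {n : ℕ} (b : BoxIdx n) (i : Fin n) (j l : ℕ) :
    (b.lower i j).lower i l = b.lower i (j + l) := by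
  simp [BoxIdx.lower, Nat.sub_sub]

theorem BoxIdx.lower_comm {n : ℕ} (b : BoxIdx n) {i l : Fin n} (h : i ≠ l) (s t : ℕ) :
    (b.lower i s).lower l t = (b.lower l t).lower i s := by
  simp only [BoxIdx.lower, Function.update_of_ne h, Function.update_of_ne h.symm]
  exact Function.update_comm h _ _ _

/-- The part of the differential that acts on the `i`-th variable. -/
def partialD (k : Type*) [Field k] (n : ℕ) (i : Fin n) : Module.End k (BoxIdx n → k) where
  toFun v b := (if (b i).val = 0 then 0 else ((b i).val : k) - ((n - i.val : ℕ) : k)) *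
    v (b.lower i 1)
  map_add' v w := by ext b; simp [mul_add]
  map_smul' c v := by ext b; simp [mul_left_comm]

theorem partialD_apply (k : Type*) [Field k] {n : ℕ} (i : Fin n) (v : BoxIdx n → k)
    (b : BoxIdx n) : partialD k n i v b =
      (if (b i).val = 0 then 0 else ((b i).val : k) - ((n - i.val : ℕ) : k)) *
        v (b.lower i 1) := rfl

/-- Division by the `i`-th variable, sending monomials not divisible by it to `0`. -/
def divVar (k : Type*) [Field k] (n : ℕ) (i : Fin n) : Module.End k (BoxIdx n → k) where
  toFun v b := if h : (b i).val + 1 < n - i.val then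
    v (Function.update b i ⟨(b i).val + 1, h⟩) else 0
  map_add' v w := by ext b; simp only [Pi.add_apply]; split_ifs <;> simp
  map_smul' c v := by ext b; simp only [Pi.smul_apply]; split_ifs <;> simp

theorem divVar_apply (k : Type*) [Field k] {n : ℕ} (i : Fin n) (v : BoxIdx n → k)
    (b : BoxIdx n) : divVar k n i v b = if h : (b i).val + 1 < n - i.val then
      v (Function.update b i ⟨(b i).val + 1, h⟩) else 0 := rfl

theorem boxD_eq_sum_partialD (k : Type*) [Field k] (n : ℕ) :
    boxD k n = ∑ i, partialD k n i := by
  refine LinearMap.ext fun v => funext fun b => ?_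
  simp only [boxD, Matrix.mulVecLin_apply, Matrix.mulVec, dotProduct, boxMat, Finset.sum_mul,
    LinearMap.sum_apply, Finset.sum_apply, partialD_apply]
  rw [Finset.sum_comm]
  refine Finset.sum_congr rfl fun i _ => ?_
  have key : ∀ a : BoxIdx n, ∀ h : (a i).val + 1 < n - i.val,
      b = Function.update a i ⟨(a i).val + 1, h⟩ → (b i).val ≠ 0 ∧ a = b.lower i 1 := by
    rintro a h rfl
    simp [BoxIdx.lower]
  rw [Finset.sum_eq_single (b.lower i 1)]
  · by_cases h0 : (b i).val = 0
    · rw [if_pos h0]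
      split_ifs with h h' <;> first | exact absurd h0 (key _ _ h').1 | simp
    · have hb := (b i).isLt
      have h : (b.lower i 1 i).val + 1 < n - i.val := by simp; omega
      have h' : b = Function.update (b.lower i 1) i ⟨(b.lower i 1 i).val + 1, h⟩ := by
        have : (⟨(b.lower i 1 i).val + 1, h⟩ : Fin (n - i.val)) = b i := by
          ext; simp; omega
        rw [this]; simp [BoxIdx.lower]
      rw [dif_pos h, if_pos h', if_neg h0]
      have e1 : ((b i).val : k) = (((b i).val - 1 : ℕ) : k) + 1 := by
        rw [← Nat.cast_succ]; congr 1; omega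
      have e2 : ((n - i.val : ℕ) : k) = ((n - 1 - i.val : ℕ) : k) + 1 := by
        rw [← Nat.cast_succ]; congr 1; omega
      rw [BoxIdx.lower_same, e1, e2]; ring
  · intro a _ ha
    split_ifs with h h' <;> first | exact absurd (key _ _ h').2 ha | simp
  · simp

theorem partialD_commute (k : Type*) [Field k] {n : ℕ} (i j : Fin n) :
    Commute (partialD k n i) (partialD k n j) := by
  rcases eq_or_ne i j with rfl | h
  · exact Commute.refl _
  · refine LinearMap.ext fun v => funext fun b => ?_
    simp only [Module.End.mul_apply, partialD_apply, BoxIdx.lower_of_ne b h,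
      BoxIdx.lower_of_ne b h.symm, BoxIdx.lower_comm b h]
    ring

theorem partialD_pow_apply (k : Type*) [Field k] {n : ℕ} (i : Fin n) (j : ℕ)
    (v : BoxIdx n → k) (b : BoxIdx n) : (partialD k n i ^ j) v b =
      if (b i).val < j then 0 else
        (∏ t ∈ Finset.range j, (((b i).val : k) - t - ((n - i.val : ℕ) : k))) *
          v (b.lower i j) := by
  induction j generalizing v with
  | zero => simp [BoxIdx.lower]
  | succ j ih =>
    rw [pow_succ, Module.End.mul_apply, ih, partialD_apply, BoxIdx.lower_lower,
      BoxIdx.lower_same, Finset.prod_range_succ]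
    by_cases h1 : (b i).val < j
    · rw [if_pos h1, if_pos (by omega)]
    · by_cases h2 : (b i).val < j + 1
      · rw [if_neg h1, if_pos h2, if_pos (by omega)]; simp
      · rw [if_neg h1, if_neg h2, if_neg (by omega), Nat.cast_sub (show j ≤ (b i).val by omega)]; ring

theorem prod_range_sub_natCast_eq_zero {k : Type*} [Field k] {p : ℕ} [CharP k p] (hp : p ≠ 0)
    (z : ℤ) : ∏ t ∈ Finset.range p, ((z : k) - t) = 0 := by
  have hp' : (p : ℤ) ≠ 0 := by exact_mod_cast hp
  have h0 := Int.emod_nonneg z hp'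
  have h1 := Int.emod_lt_of_pos z (show (0 : ℤ) < p by omega)
  refine Finset.prod_eq_zero (i := (z % p).toNat) (Finset.mem_range.2 (by omega)) ?_
  have h2 : (((z % p).toNat : ℕ) : k) = ((z % p : ℤ) : k) := by
    rw [← Int.cast_natCast, Int.toNat_of_nonneg h0]
  rw [h2, ← Int.cast_sub, CharP.intCast_eq_zero_iff k p]
  exact Int.dvd_self_sub_emod

theorem partialD_pow_char (k : Type*) [Field k] {p : ℕ} [CharP k p] (hp : p ≠ 0) {n : ℕ}
    (i : Fin n) : partialD k n i ^ p = 0 := by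
  refine LinearMap.ext fun v => funext fun b => ?_
  have h := prod_range_sub_natCast_eq_zero (k := k) hp ((b i).val - (n - i.val : ℕ) : ℤ)
  push_cast at h
  rw [partialD_pow_apply]
  simp only [sub_right_comm _ _ ((n - i.val : ℕ) : k), h]
  simp

theorem sum_pow_char_of_commute {R ι : Type*} [Semiring R] (p : ℕ) [ExpChar R p]
    (f : ι → R) (s : Finset ι) (h : ∀ i j, Commute (f i) (f j)) :
    (∑ i ∈ s, f i) ^ p = ∑ i ∈ s, f i ^ p := by
  classical
  induction s using Finset.induction_on with
  | empty => simp [(expChar_pos R p).ne']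
  | insert a s ha ih =>
    rw [Finset.sum_insert ha, Finset.sum_insert ha, ← ih]
    exact add_pow_expChar_of_commute p (Commute.sum_right _ _ _ fun j _ => h a j)

theorem boxD_pow_char (k : Type*) [Field k] {p : ℕ} (hp : p.Prime) [CharP k p] (n : ℕ) :
    boxD k n ^ p = 0 := by
  have := Fact.mk hp
  have : Nonempty (BoxIdx n) := ⟨fun i => ⟨0, by omega⟩⟩
  have : CharP (Module.End k (BoxIdx n → k)) p :=
    charP_of_injective_algebraMap (algebraMap k (Module.End k (BoxIdx n → k))).injective p
  have : ExpChar (Module.End k (BoxIdx n → k)) p := ExpChar.prime hp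
  rw [boxD_eq_sum_partialD, sum_pow_char_of_commute p _ _ (partialD_commute k)]
  exact Finset.sum_eq_zero fun i _ => partialD_pow_char k hp.ne_zero i

theorem partialD_divVar_commute (k : Type*) [Field k] {n : ℕ} {i j : Fin n} (h : j ≠ i) :
    Commute (partialD k n j) (divVar k n i) := by
  refine LinearMap.ext fun v => funext fun b => ?_
  simp only [Module.End.mul_apply, partialD_apply, divVar_apply, BoxIdx.lower_of_ne b h.symm,
    Function.update_of_ne h]
  split_ifs <;> simp [BoxIdx.lower, h, Function.update_comm h]

theorem partialD_mul_divVar (k : Type*) [Field k] {n : ℕ} (i : Fin n)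
    (hi : ((n - i.val : ℕ) : k) = 0) :
    partialD k n i * divVar k n i = divVar k n i * partialD k n i - 1 := by
  refine LinearMap.ext fun v => funext fun b => ?_
  have hb := (b i).isLt
  have e : (b i).val + 1 = n - i.val → ((b i).val : k) = -1 := fun h =>
    eq_neg_of_add_eq_zero_left (by rw [← Nat.cast_succ, Nat.succ_eq_add_one, h, hi])
  have low : ∀ h, Function.update (b.lower i 1) i ⟨(b i).val - 1 + 1, h⟩ =
      if (b i).val = 0 then Function.update b i ⟨1, by omega⟩ else b := by
    intro h
    split_ifs with h0
    · simp [BoxIdx.lower, h0]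
    · have : (⟨(b i).val - 1 + 1, h⟩ : Fin (n - i.val)) = b i := by ext; simp; omega
      rw [this]; simp [BoxIdx.lower]
  simp only [Module.End.mul_apply, partialD_apply, divVar_apply, BoxIdx.lower_same,
    LinearMap.sub_apply, Module.End.one_apply, Pi.sub_apply, low, hi]
  have up : ∀ h : (b i).val + 1 < n - i.val,
      BoxIdx.lower (Function.update b i ⟨(b i).val + 1, h⟩) i 1 = b := by
    intro h; simp [BoxIdx.lower]
  by_cases h0 : (b i).val = 0 <;> by_cases h1 : (b i).val + 1 < n - i.val
  · simp_all
  · have := e (by omega)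
    simp_all
  · have : (b i).val - 1 + 1 < n - i.val := by omega
    simp [h0, h1, this, up]; ring
  · have := e (by omega)
    have : (b i).val - 1 + 1 < n - i.val := by omega
    simp_all

theorem boxD_mul_divVar (k : Type*) [Field k] {n : ℕ} (i : Fin n)
    (hi : ((n - i.val : ℕ) : k) = 0) :
    boxD k n * divVar k n i = divVar k n i * boxD k n - 1 := by
  rw [boxD_eq_sum_partialD, Finset.sum_mul, Finset.mul_sum,
    ← Finset.add_sum_erase _ _ (Finset.mem_univ i),
    ← Finset.add_sum_erase _ (fun j => divVar k n i * partialD k n j) (Finset.mem_univ i),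
    partialD_mul_divVar k i hi,
    Finset.sum_congr rfl fun j hj => (partialD_divVar_commute k (Finset.ne_of_mem_erase hj)).eq]
  abel

end TruncatedPolynomials

section WeylRelation

theorem mul_pow_of_mul_eq_sub_one {R : Type*} [Ring R] {D Y : R} (h : D * Y = Y * D - 1)
    (j : ℕ) : D * Y ^ (j + 1) = Y ^ (j + 1) * D - (j + 1 : ℕ) * Y ^ j := by
  induction j with
  | zero => simp [h]
  | succ j ih =>
    rw [pow_succ, ← mul_assoc, ih, sub_mul, mul_assoc (Y ^ (j + 1)), h, mul_sub, ← mul_assoc,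
      mul_assoc ((j + 1 : ℕ) : R), ← pow_succ]
    push_cast
    noncomm_ring

variable {k V : Type*} [Field k] [AddCommGroup V] [Module k V] {D Y : Module.End k V}

theorem pow_pow_apply_of_mul_eq_sub_one (h : D * Y = Y * D - 1) {v : V} (hv : D v = 0) (j : ℕ) :
    (D ^ j) ((Y ^ j) v) = ((-1) ^ j * (j.factorial : k)) • v := by
  induction j with
  | zero => simp
  | succ j ih =>
    have hj : D ((Y ^ (j + 1)) v) = (-((j + 1 : ℕ) : k)) • (Y ^ j) v := by
      have := congrArg (fun f : Module.End k V => f v) (mul_pow_of_mul_eq_sub_one h j)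
      rw [← nsmul_eq_mul] at this
      simpa only [LinearMap.sub_apply, Module.End.mul_apply, hv, map_zero, zero_sub,
        LinearMap.smul_apply, neg_smul, Nat.cast_smul_eq_nsmul] using this
    rw [pow_succ D, Module.End.mul_apply, hj, map_smul, ih, smul_smul, Nat.factorial_succ]
    congr 1
    push_cast
    ring

theorem exists_pow_apply_eq_of_mul_eq_sub_one {p : ℕ} (hp : p.Prime) [CharP k p]
    (h : D * Y = Y * D - 1) {i : ℕ} (hi : i ≤ p) {v : V} (hv : (D ^ i) v = 0) :
    ∃ w, (D ^ (p - i)) w = v := by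
  induction i generalizing v with
  | zero => exact ⟨0, by simpa using hv.symm⟩
  | succ i ih =>
    obtain ⟨w, hw⟩ : ∃ w, (D ^ (p - 1)) w = (D ^ i) v := by
      have hD : D ((D ^ i) v) = 0 := by rw [← Module.End.mul_apply, ← pow_succ', hv]
      have hne : (-1) ^ (p - 1) * ((p - 1).factorial : k) ≠ 0 := by
        refine mul_ne_zero (pow_ne_zero _ (neg_ne_zero.2 one_ne_zero)) fun h0 => ?_
        rw [CharP.cast_eq_zero_iff k p, hp.dvd_factorial] at h0
        have := hp.pos
        omega
      refine ⟨((-1) ^ (p - 1) * ((p - 1).factorial : k))⁻¹ • (Y ^ (p - 1)) ((D ^ i) v), ?_⟩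
      rw [map_smul, pow_pow_apply_of_mul_eq_sub_one h hD, inv_smul_smul₀ hne]
    obtain ⟨u, hu⟩ := ih (by omega) (v := v - (D ^ (p - (i + 1))) w) (by
      rw [map_sub, ← Module.End.mul_apply, ← pow_add, ← hw,
        show i + (p - (i + 1)) = p - 1 by omega, sub_self])
    refine ⟨D u + w, ?_⟩
    rw [map_add, ← Module.End.mul_apply, ← pow_succ,
      show p - (i + 1) + 1 = p - i by omega, hu, sub_add_cancel]

end WeylRelation

/-- over a field `k` of prime characteristic `p`, the differential
`∂(x^a) = Σ_{i=1}^n (a_i - (n-i))·x₁^{a₁}⋯x_i^{a_i+1}⋯x_n^{a_n}` on the span `V` of the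
monomials `x₁^{a₁}⋯x_n^{a_n}` with `0 ≤ a_i ≤ n-i` satisfies `∂^p = 0`, and if `n ≥ p`
then `V` is acyclic: `ker(∂^i) = im(∂^{p-i})` for every `1 ≤ i ≤ p-1`. -/
theorem nilHecke_polynomial_rep_acyclic (k : Type*) [Field k] (p : ℕ) (hp : p.Prime)
    [CharP k p] (n : ℕ) (hn : 1 ≤ n) :
    (∀ v : BoxIdx n → k, (⇑(boxD k n))^[p] v = 0) ∧
    (p ≤ n → ∀ i : ℕ, 1 ≤ i → i ≤ p - 1 → ∀ v : BoxIdx n → k,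
      ((⇑(boxD k n))^[i] v = 0 ↔ ∃ w, (⇑(boxD k n))^[p - i] w = v)) := by
  refine ⟨fun v => ?_, fun hpn i _ hi v => ?_⟩
  · rw [← Module.End.coe_pow, boxD_pow_char k hp, LinearMap.zero_apply]
  · have hp0 := hp.pos
    simp only [← Module.End.coe_pow]
    have hcast : ((n - (⟨n - p, by omega⟩ : Fin n).val : ℕ) : k) = 0 := by
      rw [CharP.cast_eq_zero_iff k p]
      exact (Nat.sub_sub_self hpn).symm ▸ dvd_rfl
    refine ⟨exists_pow_apply_eq_of_mul_eq_sub_one hp (boxD_mul_divVar k _ hcast) (by omega), ?_⟩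
    rintro ⟨w, rfl⟩
    rw [← Module.End.mul_apply, ← pow_add, Nat.add_sub_cancel' (by omega), boxD_pow_char k hp,
      LinearMap.zero_apply]
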